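/- Suppose p ≡ 3 (mod 4) and m ≥ 3 is odd. Then CWE(C_D) = w_0^{(p−1)p^{m−1}/2} + (p^{m−1}−1)·Π_{ρ∈F_p} w_ρ^{(p−1)p^{m−2}/2} + ((p−1)/4)(p^{m−1}+p^{(m−1)/2}) · w_0^{((p−1)/2)(p^{m−2}−p^{(m−3)/2})} · Σ_{i∈{1,−1}} [Π_{ρ∈F_p^*, η̄(ρ)=i} w_ρ^{A_1}] · [Π_{z∈F_p^*, η̄(z)=−i} w_z^{B_1}] + ((p−1)/4)(p^{m−1}−p^{(m−1)/2}) · w_0^{((p−1)/2)(p^{m−2}+p^{(m−3)/2})} · Σ_{i∈{1,−1}} [Π_{ρ∈F_p^*, η̄(ρ)=i} w_ρ^{A_{−1}}] · [Π_{z∈F_p^*, η̄(z)=−i} w_z^{B_{−1}}], where for ε ∈ {1,−1}: A_ε = ((p−1)/2)(p^{m−2} − ε·p^{(m−3)/2}) and B_ε = (p−1)p^{m−2}/2 + ε·((p+1)/2)·p^{(m−3)/2}. -/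

import Mathlib

open MvPolynomial

/-- `N_a(ρ) = #{x ∈ D : Tr(a x²) = ρ}` where `D = {x ∈ F_r^* : Tr(x) ∈ Sq}`. -/
noncomputable def Nfun (p : ℕ) (F : Type) [Field F] [Algebra (ZMod p) F]
    (a : F) (ρ : ZMod p) : ℕ :=
  Set.ncard {x : F | (x ≠ 0 ∧ IsSquare (Algebra.trace (ZMod p) F x) ∧
    Algebra.trace (ZMod p) F x ≠ 0) ∧ Algebra.trace (ZMod p) F (a * x ^ 2) = ρ}

/-- The complete weight enumerator `CWE(C_D) = Σ_{a ∈ F_r} Π_{ρ ∈ F_p} w_ρ^{N_a(ρ)}`. -/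
noncomputable def CWE (p : ℕ) [NeZero p] (F : Type) [Field F] [Fintype F]
    [Algebra (ZMod p) F] : MvPolynomial (ZMod p) ℤ :=
  ∑ a : F, ∏ ρ : ZMod p, (X ρ : MvPolynomial (ZMod p) ℤ) ^ (Nfun p F a ρ)


set_option linter.unusedSectionVars false

section Gen
variable {K : Type} [Field K] [Fintype K] [DecidableEq K]

theorem sum_sq_eq {R : Type} [CommRing R] (hK : ringChar K ≠ 2) (f : K → R) :
    ∑ x : K, f (x ^ 2) = ∑ y : K, ((quadraticChar K y : ℤ) + 1 : R) * f y := by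
  have h : ∀ x : K, f (x ^ 2) = ∑ y : K, if x ^ 2 = y then f y else 0 := by
    intro x; simp
  simp_rw [h]
  rw [Finset.sum_comm]
  refine Finset.sum_congr rfl fun y _ => ?_
  rw [← Finset.sum_filter, Finset.sum_const, nsmul_eq_mul]
  congr 1
  have := quadraticChar_card_sqrts hK y
  have h2 : (({x : K | x ^ 2 = y}.toFinset.card : ℤ) : R) = ((quadraticChar K y + 1 : ℤ) : R) := by
    rw [this]
  push_cast at h2
  rw [← h2]
  congr 2
  ext x; simp

/-- complex Gauss sum of the quadratic character -/
noncomputable def GS (ψ : AddChar K ℂ) : ℂ := ∑ z : K, (quadraticChar K z : ℂ) * ψ z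

theorem GS_sq (hK : ringChar K ≠ 2) {ψ : AddChar K ℂ} (hψ : ψ.IsPrimitive) :
    GS ψ ^ 2 = (quadraticChar K (-1) : ℂ) * Fintype.card K := by
  have := gaussSum_sq (χ := (quadraticChar K).ringHomComp (Int.castRingHom ℂ)) (ψ := ψ)
    ?_ ?_ hψ
  · simpa [gaussSum, GS] using this
  · intro h
    apply quadraticChar_ne_one hK
    ext a
    have := DFunLike.congr_fun h (a : K)
    simp only [MulChar.ringHomComp_apply, MulChar.one_apply_coe, Int.coe_castRingHom] at this
    simp only [MulChar.one_apply_coe]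
    exact_mod_cast this
  · exact (quadraticChar_isQuadratic K).comp _

theorem char_sum_zero (hK : ringChar K ≠ 2) : ∑ z : K, (quadraticChar K z : ℂ) = 0 := by
  have := quadraticChar_sum_zero hK
  exact_mod_cast congrArg (Int.cast : ℤ → ℂ) this

theorem qc_mul_self {b : K} (hb : b ≠ 0) :
    (quadraticChar K b : ℂ) * (quadraticChar K b : ℂ) = 1 := by
  rcases quadraticChar_dichotomy hb with h | h <;> simp [h]

theorem GS_shift (hK : ringChar K ≠ 2) (ψ : AddChar K ℂ) (b : K) :
    ∑ z : K, (quadraticChar K z : ℂ) * ψ (z * b) = (quadraticChar K b : ℂ) * GS ψ := by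
  by_cases hb : b = 0
  · subst hb; simpa using char_sum_zero hK
  · rw [GS, ← Equiv.sum_comp (Equiv.mulRight₀ b hb) (fun z => (quadraticChar K z : ℂ) * ψ z),
      Finset.mul_sum]
    refine Finset.sum_congr rfl fun z _ => ?_
    have := qc_mul_self hb
    change _ = _ * (((quadraticChar K (z * b) : ℤ) : ℂ) * ψ (z * b))
    rw [map_mul (quadraticChar K), Int.cast_mul]
    linear_combination (-(quadraticChar K z : ℂ) * ψ (z * b)) * this

theorem quad_sum (hK : ringChar K ≠ 2) {ψ : AddChar K ℂ} (hψ : ψ.IsPrimitive) {b : K}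
    (hb : b ≠ 0) :
    ∑ x : K, ψ (x ^ 2 * b) = (quadraticChar K b : ℂ) * GS ψ := by
  rw [sum_sq_eq hK (fun y => ψ (y * b)), ← GS_shift hK]
  simp_rw [add_mul, one_mul]
  rw [Finset.sum_add_distrib, AddChar.sum_mulShift b hψ]
  simp [hb]

end Gen

section Main
variable {p : ℕ} [Fact p.Prime] {F : Type} [Field F] [Fintype F] [Algebra (ZMod p) F]

/-- trace character -/
noncomputable def psi (p : ℕ) [Fact p.Prime] (F : Type) [Field F] [Algebra (ZMod p) F] :
    AddChar F ℂ :=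
  (ZMod.stdAddChar (N := p)).compAddMonoidHom (Algebra.trace (ZMod p) F).toAddMonoidHom

theorem psi_apply (x : F) : psi p F x = ZMod.stdAddChar (Algebra.trace (ZMod p) F x) := rfl

theorem tr_surj : Function.Surjective (Algebra.trace (ZMod p) F) := by
  have : Finite F := inferInstance
  exact Algebra.trace_surjective (ZMod p) F

theorem psi_prim : (psi p F).IsPrimitive := by
  intro a ha h
  have h1 : ZMod.stdAddChar (N := p) ≠ 1 := by
    have := ZMod.isPrimitive_stdAddChar p (one_ne_zero)
    simpa using this
  apply h1
  ext y
  obtain ⟨x, hx⟩ := tr_surj (F := F) y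
  have := DFunLike.congr_fun h (a⁻¹ * x)
  simp only [AddChar.mulShift_apply, psi_apply, mul_inv_cancel_left₀ ha, hx] at this
  simpa using this

theorem tr_scal (z : ZMod p) (x : F) :
    Algebra.trace (ZMod p) F (algebraMap (ZMod p) F z * x) = z * Algebra.trace (ZMod p) F x := by
  rw [← Algebra.smul_def, map_smul, smul_eq_mul]

theorem ringChar_ne (hp4 : p % 4 = 3) : ringChar F ≠ 2 := by
  have : CharP F p := charP_of_injective_algebraMap (algebraMap (ZMod p) F).injective p
  rw [ringChar.eq F p]; omega

theorem qc_neg_one {K : Type} [Field K] [Fintype K] [DecidableEq K] (h : Fintype.card K % 4 = 3) :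
    quadraticChar K (-1) = -1 := by
  rw [quadraticChar_neg_one_iff_not_isSquare, FiniteField.isSquare_neg_one_iff]
  simpa using h

theorem card_mod {m : ℕ} (hp4 : p % 4 = 3) (hmo : Odd m) : p ^ m % 4 = 3 := by
  obtain ⟨k, rfl⟩ := hmo
  rw [pow_succ, pow_mul, Nat.mul_mod, Nat.pow_mod, Nat.pow_mod p, hp4]; simp

theorem qc_algebraMap [DecidableEq F] (hp4 : p % 4 = 3) (hF : Fintype.card F % 4 = 3)
    (z : ZMod p) :
    quadraticChar F (algebraMap (ZMod p) F z) = quadraticChar (ZMod p) z := by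
  have hz1 : quadraticChar (ZMod p) (-1) = -1 := qc_neg_one (by simpa [ZMod.card])
  have key : ∀ z : ZMod p, z ≠ 0 → IsSquare z →
      quadraticChar F (algebraMap (ZMod p) F z) = 1 := by
    intro z hz hs
    rw [quadraticChar_one_iff_isSquare (by simpa using hz)]
    exact hs.map _
  by_cases hz : z = 0
  · simp [hz]
  · rcases quadraticChar_dichotomy hz with h | h
    · rw [h, key z hz ((quadraticChar_one_iff_isSquare hz).1 h)]
    · have : quadraticChar (ZMod p) (-z) = 1 := by
        rw [neg_eq_neg_one_mul, map_mul, hz1, h]; rfl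
      have h2 := key (-z) (by simpa) ((quadraticChar_one_iff_isSquare (by simpa)).1 this)
      rw [map_neg, neg_eq_neg_one_mul, map_mul, qc_neg_one hF] at h2
      rw [h]; linarith


/-- number of solutions of `Tr(a x^2) = ρ` -/
noncomputable def Cc (p : ℕ) (F : Type) [Field F] [Fintype F] [Algebra (ZMod p) F]
    (a : F) (ρ : ZMod p) : ℕ :=
  (Finset.univ.filter (fun x : F => Algebra.trace (ZMod p) F (a * x ^ 2) = ρ)).card

/-- number of solutions of `Tr(a x^2) = ρ`, `Tr x = 0` -/
noncomputable def Mc (p : ℕ) (F : Type) [Field F] [Fintype F] [Algebra (ZMod p) F]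
    (a : F) (ρ : ZMod p) : ℕ :=
  (Finset.univ.filter (fun x : F => Algebra.trace (ZMod p) F (a * x ^ 2) = ρ ∧
    Algebra.trace (ZMod p) F x = 0)).card

theorem std_sum (b : ZMod p) :
    ∑ z : ZMod p, ZMod.stdAddChar (z * b) = if b = 0 then (p : ℂ) else 0 := by
  rw [AddChar.sum_mulShift b (ZMod.isPrimitive_stdAddChar p)]
  simp

theorem cw_inner [DecidableEq F] (hp4 : p % 4 = 3) (hF : Fintype.card F % 4 = 3)
    {a : F} (ha : a ≠ 0) {z : ZMod p} (hz : z ≠ 0) :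
    ∑ x : F, ZMod.stdAddChar (z * Algebra.trace (ZMod p) F (a * x ^ 2)) =
      (quadraticChar (ZMod p) z : ℂ) * (quadraticChar F a : ℂ) * GS (psi p F) := by
  have hz' : algebraMap (ZMod p) F z ≠ 0 := by simpa using hz
  have := quad_sum (ringChar_ne (F := F) hp4) (psi_prim (p := p)) (mul_ne_zero hz' ha)
  rw [map_mul, qc_algebraMap hp4 hF, Int.cast_mul] at this
  rw [← this]
  refine Finset.sum_congr rfl fun x _ => ?_
  rw [psi_apply, ← tr_scal]
  congr 2; ring

theorem count_C [DecidableEq F] (hp4 : p % 4 = 3) (hF : Fintype.card F % 4 = 3)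
    {a : F} (ha : a ≠ 0) (ρ : ZMod p) :
    (p : ℂ) * Cc p F a ρ = Fintype.card F + (quadraticChar F a : ℂ) * GS (psi p F) *
      ((quadraticChar (ZMod p) (-ρ) : ℂ) * GS (ZMod.stdAddChar (N := p))) := by
  have h1 : (p : ℂ) * Cc p F a ρ =
      ∑ z : ZMod p, ∑ x : F, ZMod.stdAddChar (z * (Algebra.trace (ZMod p) F (a * x ^ 2) - ρ)) := by
    rw [Finset.sum_comm]
    simp_rw [std_sum, sub_eq_zero]
    rw [← Finset.sum_filter, Finset.sum_const, nsmul_eq_mul, mul_comm]; rfl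
  have h2 : ∀ z : ZMod p,
      ∑ x : F, ZMod.stdAddChar (z * (Algebra.trace (ZMod p) F (a * x ^ 2) - ρ)) =
      (if z = 0 then (Fintype.card F : ℂ) else 0) + (quadraticChar F a : ℂ) * GS (psi p F) *
       ((quadraticChar (ZMod p) z : ℂ) * ZMod.stdAddChar (z * (-ρ))) := by
    intro z
    by_cases hz : z = 0
    · simp [hz]
    · simp_rw [mul_sub, sub_eq_add_neg, AddChar.map_add_eq_mul, ← Finset.sum_mul]
      rw [cw_inner hp4 hF ha hz, if_neg hz, mul_neg]; ring
  rw [h1, Finset.sum_congr rfl fun z _ => h2 z, Finset.sum_add_distrib, ← Finset.mul_sum,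
    GS_shift (ringChar_ne hp4)]
  simp

theorem cw_inner2 [DecidableEq F] (hp4 : p % 4 = 3) (hF : Fintype.card F % 4 = 3)
    {a : F} (ha : a ≠ 0) {z : ZMod p} (hz : z ≠ 0) (u : ZMod p) :
    ∑ x : F, ZMod.stdAddChar (z * Algebra.trace (ZMod p) F (a * x ^ 2) +
        u * Algebra.trace (ZMod p) F x) =
      (quadraticChar (ZMod p) z : ℂ) * (quadraticChar F a : ℂ) * GS (psi p F) *
      ZMod.stdAddChar (u ^ 2 * (- Algebra.trace (ZMod p) F a⁻¹ * (4 * z)⁻¹)) := by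
  have hz' : algebraMap (ZMod p) F z ≠ 0 := by simpa using hz
  have h2F : (2 : F) ≠ 0 := Ring.two_ne_zero (ringChar_ne (p := p) hp4)
  have h2 : (2 : ZMod p) ≠ 0 := Ring.two_ne_zero (ringChar_ne (p := p) hp4)
  have h4 : (4 : ZMod p) ≠ 0 := by
    have : (4 : ZMod p) = 2 * 2 := by norm_num
    rw [this]; exact mul_ne_zero h2 h2
  have h4F : (4 : F) ≠ 0 := by
    have : (4 : F) = 2 * 2 := by norm_num
    rw [this]; exact mul_ne_zero h2F h2F
  rw [← cw_inner hp4 hF ha hz, Finset.sum_mul,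
    ← Equiv.sum_comp (Equiv.addRight (algebraMap (ZMod p) F u *
      (2 * algebraMap (ZMod p) F z * a)⁻¹)) (fun x => _ * _)]
  refine Finset.sum_congr rfl fun x _ => ?_
  rw [← AddChar.map_add_eq_mul]
  congr 1
  simp only [Equiv.coe_addRight]
  have e : u ^ 2 * (- Algebra.trace (ZMod p) F a⁻¹ * (4 * z)⁻¹) =
      (- u ^ 2 * (4 * z)⁻¹) * Algebra.trace (ZMod p) F a⁻¹ := by ring
  rw [e, ← tr_scal, ← tr_scal, ← tr_scal, ← tr_scal, ← map_add, ← map_add]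
  congr 1
  simp only [map_mul, map_neg, map_pow, map_inv₀, map_ofNat]
  field_simp
  ring

theorem count_M [DecidableEq F] (hp4 : p % 4 = 3) (hF : Fintype.card F % 4 = 3)
    {a : F} (ha : a ≠ 0) (ρ : ZMod p) :
    (p : ℂ) ^ 2 * Mc p F a ρ = Fintype.card F + (quadraticChar F a : ℂ) * GS (psi p F) *
      (if Algebra.trace (ZMod p) F a⁻¹ = 0 then
        p * ((quadraticChar (ZMod p) (-ρ) : ℂ) * GS (ZMod.stdAddChar (N := p)))
      else (quadraticChar (ZMod p) (- Algebra.trace (ZMod p) F a⁻¹) : ℂ) *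
        GS (ZMod.stdAddChar (N := p)) * ((if ρ = 0 then (p : ℂ) else 0) - 1)) := by
  have hpr : ringChar (ZMod p) ≠ 2 := ringChar_ne hp4
  have h1 : (p : ℂ) ^ 2 * Mc p F a ρ =
      ∑ z : ZMod p, ∑ u : ZMod p, ∑ x : F,
        ZMod.stdAddChar (z * (Algebra.trace (ZMod p) F (a * x ^ 2) - ρ)) *
        ZMod.stdAddChar (u * Algebra.trace (ZMod p) F x) := by
    have : ∀ z : ZMod p, ∑ u : ZMod p, ∑ x : F,
        ZMod.stdAddChar (z * (Algebra.trace (ZMod p) F (a * x ^ 2) - ρ)) *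
        ZMod.stdAddChar (u * Algebra.trace (ZMod p) F x) =
        ∑ x : F, ∑ u : ZMod p, 
        ZMod.stdAddChar (z * (Algebra.trace (ZMod p) F (a * x ^ 2) - ρ)) *
        ZMod.stdAddChar (u * Algebra.trace (ZMod p) F x) := fun z => Finset.sum_comm
    simp_rw [this, ← Finset.mul_sum, std_sum]
    rw [Finset.sum_comm]
    have e : ∀ P Q : Prop, ∀ [Decidable P] [Decidable Q],
        (if P then (p : ℂ) else 0) * (if Q then (p : ℂ) else 0) =
          if P ∧ Q then (p : ℂ) ^ 2 else 0 := by
      intro P Q _ _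
      by_cases hP : P <;> by_cases hQ : Q <;> simp [hP, hQ, sq]
    simp_rw [← Finset.sum_mul, std_sum, sub_eq_zero, e]
    rw [← Finset.sum_filter, Finset.sum_const, nsmul_eq_mul, mul_comm]; rfl
  have h0 : ∑ u : ZMod p, ∑ x : F,
        ZMod.stdAddChar (0 * (Algebra.trace (ZMod p) F (a * x ^ 2) - ρ)) *
        ZMod.stdAddChar (u * Algebra.trace (ZMod p) F x) = (Fintype.card F : ℂ) := by
    rw [Finset.sum_eq_single 0]
    · simp
    · intro u _ hu
      have := AddChar.sum_mulShift (algebraMap (ZMod p) F u) (psi_prim (p := p) (F := F))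
      rw [if_neg (by simpa using hu)] at this
      rw [Nat.cast_zero] at this
      rw [← this]
      refine Finset.sum_congr rfl fun x _ => ?_
      rw [psi_apply, mul_comm x, tr_scal]; simp
    · simp
  have h2 : ∀ z : ZMod p, z ≠ 0 → ∑ u : ZMod p, ∑ x : F,
        ZMod.stdAddChar (z * (Algebra.trace (ZMod p) F (a * x ^ 2) - ρ)) *
        ZMod.stdAddChar (u * Algebra.trace (ZMod p) F x) =
      (quadraticChar F a : ℂ) * GS (psi p F) * ((quadraticChar (ZMod p) z : ℂ) *
        ZMod.stdAddChar (z * (-ρ))) *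
       ∑ u : ZMod p, ZMod.stdAddChar (u ^ 2 * (- Algebra.trace (ZMod p) F a⁻¹ * (4 * z)⁻¹)) := by
    intro z hz
    rw [Finset.mul_sum]
    refine Finset.sum_congr rfl fun u _ => ?_
    have := cw_inner2 hp4 hF ha hz u
    have e : ∀ x : F, ZMod.stdAddChar (z * (Algebra.trace (ZMod p) F (a * x ^ 2) - ρ)) *
        ZMod.stdAddChar (u * Algebra.trace (ZMod p) F x) = ZMod.stdAddChar (z * (-ρ)) *
        ZMod.stdAddChar (z * Algebra.trace (ZMod p) F (a * x ^ 2) +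
        u * Algebra.trace (ZMod p) F x) := by
      intro x
      rw [← AddChar.map_add_eq_mul, ← AddChar.map_add_eq_mul]; congr 1; ring
    simp_rw [e, ← Finset.mul_sum]
    rw [this]; ring
  have h3 : ∀ z : ZMod p, ∑ u : ZMod p, ∑ x : F,
        ZMod.stdAddChar (z * (Algebra.trace (ZMod p) F (a * x ^ 2) - ρ)) *
        ZMod.stdAddChar (u * Algebra.trace (ZMod p) F x) =
      (if z = 0 then (Fintype.card F : ℂ) else 0) +
      (quadraticChar F a : ℂ) * GS (psi p F) *
      (if Algebra.trace (ZMod p) F a⁻¹ = 0 then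
        p * ((quadraticChar (ZMod p) z : ℂ) * ZMod.stdAddChar (z * (-ρ)))
      else (quadraticChar (ZMod p) (- Algebra.trace (ZMod p) F a⁻¹) : ℂ) *
        GS (ZMod.stdAddChar (N := p)) * (ZMod.stdAddChar (z * (-ρ)) -
          (if z = 0 then 1 else 0))) := by
    intro z
    by_cases hz : z = 0
    · subst hz; rw [h0]; simp
    · rw [h2 z hz, if_neg hz]
      split_ifs with hT
      · simp [hT]; ring
      · have h2' : (2 : ZMod p) ≠ 0 := Ring.two_ne_zero hpr
        have h4 : (4 : ZMod p) = 2 ^ 2 := by norm_num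
        have h4n : (4 : ZMod p) ≠ 0 := by rw [h4]; exact pow_ne_zero _ h2'
        rw [quad_sum hpr (ZMod.isPrimitive_stdAddChar p)
          (mul_ne_zero (neg_ne_zero.2 hT) (inv_ne_zero (mul_ne_zero h4n hz)))]
        have e : quadraticChar (ZMod p) (- Algebra.trace (ZMod p) F a⁻¹ * (4 * z)⁻¹) =
            quadraticChar (ZMod p) (- Algebra.trace (ZMod p) F a⁻¹) * quadraticChar (ZMod p) z := by
          rw [map_mul]; congr 1
          have : (4 * z)⁻¹ = ((2 * z)⁻¹) ^ 2 * z := by rw [h4]; field_simp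
          rw [this, map_mul, quadraticChar_sq_one' (inv_ne_zero (mul_ne_zero h2' hz)), one_mul]
        rw [e]
        have := qc_mul_self hz
        push_cast
        linear_combination ((quadraticChar F a : ℂ) * GS (psi p F) * ZMod.stdAddChar (z * (-ρ)) *
          (quadraticChar (ZMod p) (- Algebra.trace (ZMod p) F a⁻¹)) *
          GS (ZMod.stdAddChar (N := p))) * this
  rw [h1, Finset.sum_congr rfl fun z _ => h3 z, Finset.sum_add_distrib, ← Finset.mul_sum]
  congr 2
  · simp
  · split_ifs with hT h
    · rw [← Finset.mul_sum, GS_shift hpr]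
    · rw [← Finset.mul_sum, Finset.sum_sub_distrib, std_sum]; simp [h]
    · rw [← Finset.mul_sum, Finset.sum_sub_distrib, std_sum]; simp [h]

theorem exists_sigma [DecidableEq F] (hp4 : p % 4 = 3) (n : ℕ)
    (hcard : Fintype.card F = p ^ (2 * n + 3)) :
    ∃ σ : ℤ, (σ = 1 ∨ σ = -1) ∧ (GS (psi p F) * GS (ZMod.stdAddChar (N := p)) : ℂ) =
      - σ * (p : ℂ) ^ (n + 2) := by
  have hF : Fintype.card F % 4 = 3 := by
    rw [hcard]; exact card_mod hp4 ⟨n + 1, by ring⟩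
  have h1 := GS_sq (ringChar_ne (F := F) hp4) (psi_prim (p := p) (F := F))
  have h2 := GS_sq (ringChar_ne (F := ZMod p) hp4) (ZMod.isPrimitive_stdAddChar p)
  rw [qc_neg_one hF, hcard] at h1
  rw [qc_neg_one (by simpa [ZMod.card]), ZMod.card] at h2
  have h3 : (GS (psi p F) * GS (ZMod.stdAddChar (N := p)) : ℂ) ^ 2 = ((p : ℂ) ^ (n + 2)) ^ 2 := by
    rw [mul_pow, h1, h2]; push_cast; ring
  rcases sq_eq_sq_iff_eq_or_eq_neg.1 h3 with h | h
  · exact ⟨-1, Or.inr rfl, by rw [h]; simp⟩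
  · exact ⟨1, Or.inl rfl, by rw [h]; simp⟩

theorem qc_neg (hp4 : p % 4 = 3) (z : ZMod p) :
    quadraticChar (ZMod p) (-z) = - quadraticChar (ZMod p) z := by
  rw [neg_eq_neg_one_mul, map_mul, qc_neg_one (by simpa [ZMod.card])]; ring

theorem counts [DecidableEq F] (hp4 : p % 4 = 3) (n : ℕ)
    (hcard : Fintype.card F = p ^ (2 * n + 3)) :
    ∃ σ : ℤ, (σ = 1 ∨ σ = -1) ∧ ∀ a : F, a ≠ 0 → ∀ ρ : ZMod p,
      (Cc p F a ρ : ℤ) = p ^ (2 * n + 2) +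
        σ * quadraticChar F a * quadraticChar (ZMod p) ρ * p ^ (n + 1) ∧
      (Mc p F a ρ : ℤ) = p ^ (2 * n + 1) + σ * quadraticChar F a *
        (if Algebra.trace (ZMod p) F a⁻¹ = 0 then quadraticChar (ZMod p) ρ * p ^ (n + 1)
         else quadraticChar (ZMod p) (Algebra.trace (ZMod p) F a⁻¹) * p ^ n *
          ((if ρ = 0 then (p : ℤ) else 0) - 1)) := by
  have hF : Fintype.card F % 4 = 3 := by
    rw [hcard]; exact card_mod hp4 ⟨n + 1, by ring⟩
  obtain ⟨σ, hσ, h⟩ := exists_sigma (F := F) hp4 n hcard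
  refine ⟨σ, hσ, fun a ha ρ => ?_⟩
  have hC := count_C hp4 hF ha ρ
  have hM := count_M hp4 hF ha ρ
  rw [hcard] at hC hM
  have hp0 : (p : ℂ) ≠ 0 := by exact_mod_cast (Fact.out : p.Prime).ne_zero
  rw [qc_neg hp4] at hC hM
  rw [qc_neg hp4] at hM
  push_cast at hC hM
  constructor
  · have : (Cc p F a ρ : ℂ) = p ^ (2 * n + 2) +
        σ * quadraticChar F a * quadraticChar (ZMod p) ρ * p ^ (n + 1) := by
      apply mul_left_cancel₀ hp0
      rw [hC]
      linear_combination (-(quadraticChar F a : ℂ) * (quadraticChar (ZMod p) ρ : ℂ)) * h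
    exact_mod_cast this
  · have : (Mc p F a ρ : ℂ) = p ^ (2 * n + 1) + σ * quadraticChar F a *
        (if Algebra.trace (ZMod p) F a⁻¹ = 0 then (quadraticChar (ZMod p) ρ : ℂ) * p ^ (n + 1)
         else (quadraticChar (ZMod p) (Algebra.trace (ZMod p) F a⁻¹) : ℂ) * p ^ n *
          ((if ρ = 0 then (p : ℂ) else 0) - 1)) := by
      apply mul_left_cancel₀ (pow_ne_zero 2 hp0)
      rw [hM]
      split_ifs with hT h0
      · linear_combination (-(quadraticChar F a : ℂ) * p * (quadraticChar (ZMod p) ρ : ℂ)) * h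
      · linear_combination (-(quadraticChar F a : ℂ) * (p - 1) *
          (quadraticChar (ZMod p) (Algebra.trace (ZMod p) F a⁻¹) : ℂ)) * h
      · linear_combination ((quadraticChar F a : ℂ) *
          (quadraticChar (ZMod p) (Algebra.trace (ZMod p) F a⁻¹) : ℂ)) * h
    exact_mod_cast this

end Main

section Arith

/-- exponent `A_e` -/
def expA (p n : ℕ) (e : ℤ) : ℕ :=
  if e = 1 then (p - 1) / 2 * (p ^ (2 * n + 1) - p ^ n) else (p - 1) / 2 * (p ^ (2 * n + 1) + p ^ n)

/-- exponent `B_e` -/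
def expB (p n : ℕ) (e : ℤ) : ℕ :=
  if e = 1 then (p - 1) / 2 * p ^ (2 * n + 1) + (p + 1) / 2 * p ^ n
  else (p - 1) / 2 * p ^ (2 * n + 1) - (p + 1) / 2 * p ^ n

theorem cast_expA {p n : ℕ} (hp4 : p % 4 = 3) {e : ℤ} (he : e = 1 ∨ e = -1) :
    2 * (expA p n e : ℤ) = (p - 1) * (p ^ (2 * n + 1) - e * p ^ n) := by
  obtain ⟨k, hk⟩ : ∃ k, p = 4 * k + 3 := ⟨p / 4, by omega⟩
  have h1 : (p - 1) / 2 = 2 * k + 1 := by omega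
  have h2 : (p : ℤ) = 4 * k + 3 := by exact_mod_cast hk
  have h3 : p ^ n ≤ p ^ (2 * n + 1) := Nat.pow_le_pow_right (by omega) (by omega)
  rcases he with rfl | rfl
  · simp only [expA, if_true, h1]
    push_cast [Nat.cast_sub h3]
    rw [h2]; ring
  · simp only [expA, h1]
    norm_num
    rw [h2]; ring

theorem cast_expB {p n : ℕ} (hp4 : p % 4 = 3) {e : ℤ} (he : e = 1 ∨ e = -1) :
    2 * (expB p n e : ℤ) = (p - 1) * p ^ (2 * n + 1) + e * (p + 1) * p ^ n := by
  obtain ⟨k, hk⟩ : ∃ k, p = 4 * k + 3 := ⟨p / 4, by omega⟩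
  have h1 : (p - 1) / 2 = 2 * k + 1 := by omega
  have h1' : (p + 1) / 2 = 2 * k + 2 := by omega
  have h2 : (p : ℤ) = 4 * k + 3 := by exact_mod_cast hk
  have h3 : (2 * k + 2) * p ^ n ≤ (2 * k + 1) * p ^ (2 * n + 1) := by
    have : p ^ n ≤ p ^ (2 * n) := Nat.pow_le_pow_right (by omega) (by omega)
    calc (2 * k + 2) * p ^ n ≤ ((2 * k + 1) * p) * p ^ (2 * n) :=
          Nat.mul_le_mul (by rw [hk]; nlinarith) this
      _ = _ := by ring
  rcases he with rfl | rfl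
  · simp only [expB, if_true, h1, h1']
    push_cast
    rw [h2]; ring
  · simp only [expB, h1, h1']
    norm_num
    push_cast [Nat.cast_sub h3]
    rw [h2]; ring

theorem exp_eq {p n N : ℕ} (hp4 : p % 4 = 3) {s e r : ℤ} (hs : s = 1 ∨ s = -1)
    (he : e = 1 ∨ e = -1) (hr : r = 0 ∨ r = 1 ∨ r = -1)
    (h : 2 * (N : ℤ) = p ^ (2 * n + 2) + s * r * p ^ (n + 1) -
      (p ^ (2 * n + 1) + e * p ^ n * ((if r = 0 then (p : ℤ) else 0) - 1))) :
    N = if s * r * e = 1 then expB p n e else expA p n e := by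
  have hA := cast_expA (n := n) hp4 he
  have hB := cast_expB (n := n) hp4 he
  have hAB : 2 * ((if s * r * e = 1 then expB p n e else expA p n e : ℕ) : ℤ) = 2 * (N : ℤ) := by
    rw [h]
    rcases hs with rfl | rfl <;> rcases he with rfl | rfl <;> rcases hr with rfl | rfl | rfl <;>
      norm_num [hA, hB] <;> ring
  have := mul_left_cancel₀ (two_ne_zero) hAB
  exact_mod_cast this.symm

end Arith

section Main2
variable {p : ℕ} [Fact p.Prime] {F : Type} [Field F] [Fintype F] [Algebra (ZMod p) F]

theorem Nfun_rel (hp4 : p % 4 = 3) (a : F) (ρ : ZMod p) :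
    2 * Nfun p F a ρ + Mc p F a ρ = Cc p F a ρ := by
  have h1 : Nfun p F a ρ = (Finset.univ.filter (fun x : F =>
      quadraticChar (ZMod p) (Algebra.trace (ZMod p) F x) = 1 ∧
      Algebra.trace (ZMod p) F (a * x ^ 2) = ρ)).card := by
    rw [Nfun, ← Set.ncard_coe_finset]
    congr 1
    ext x
    simp only [Set.mem_ofPred_eq, Finset.coe_filter, Finset.mem_univ, true_and]
    constructor
    · rintro ⟨⟨_, h2, h3⟩, h4⟩
      exact ⟨(quadraticChar_one_iff_isSquare h3).2 h2, h4⟩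
    · rintro ⟨h1, h2⟩
      have h3 : Algebra.trace (ZMod p) F x ≠ 0 := by
        intro h; rw [h] at h1; simp at h1
      refine ⟨⟨?_, (quadraticChar_one_iff_isSquare h3).1 h1, h3⟩, h2⟩
      rintro rfl; simp at h3
  have h2 : Nfun p F a ρ = (Finset.univ.filter (fun x : F =>
      quadraticChar (ZMod p) (Algebra.trace (ZMod p) F x) = -1 ∧
      Algebra.trace (ZMod p) F (a * x ^ 2) = ρ)).card := by
    rw [h1, Finset.card_filter, Finset.card_filter, ← Equiv.sum_comp (Equiv.neg F)]
    refine Finset.sum_congr rfl fun x _ => ?_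
    simp only [Equiv.neg_apply, map_neg, qc_neg hp4, neg_sq, neg_eq_iff_eq_neg]
  rw [two_mul]
  nth_rw 1 [h1]
  rw [h2, Mc, Cc]
  simp only [Finset.card_filter]
  rw [← Finset.sum_add_distrib, ← Finset.sum_add_distrib]
  refine Finset.sum_congr rfl fun x _ => ?_
  by_cases h0 : Algebra.trace (ZMod p) F x = 0
  · simp [h0]
  · rcases quadraticChar_dichotomy h0 with h | h <;> rw [h] <;> simp [h0]

/-- number of `b` with given quadratic characters of `b` and of `Tr b` -/
noncomputable def Kc (p : ℕ) [Fact p.Prime] (F : Type) [Field F] [Fintype F] [DecidableEq F]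
    [Algebra (ZMod p) F] (s t : ℤ) : ℕ :=
  (Finset.univ.filter (fun b : F => quadraticChar F b = s ∧
    quadraticChar (ZMod p) (Algebra.trace (ZMod p) F b) = t)).card

theorem half_count (hp4 : p % 4 = 3) {t : ℤ} (ht : t = 1 ∨ t = -1) :
    2 * ((Finset.univ.filter (fun z : ZMod p => quadraticChar (ZMod p) z = t)).card : ℤ) =
      p - 1 := by
  have h0 := quadraticChar_sum_zero (F := ZMod p) (ringChar_ne hp4)
  have h : ∀ z : ZMod p, 2 * (if quadraticChar (ZMod p) z = t then (1 : ℤ) else 0) =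
      1 + t * quadraticChar (ZMod p) z - if z = 0 then 1 else 0 := by
    intro z
    by_cases hz : z = 0
    · subst hz
      rcases ht with rfl | rfl <;> simp
    · rcases quadraticChar_dichotomy hz with h | h <;> rcases ht with rfl | rfl <;>
        rw [h, if_neg hz] <;> norm_num
  rw [Finset.card_filter]
  push_cast
  rw [Finset.mul_sum, Finset.sum_congr rfl fun z _ => h z, Finset.sum_sub_distrib,
    Finset.sum_add_distrib, ← Finset.mul_sum, h0]
  simp [ZMod.card]

theorem Kc_eq [DecidableEq F] (hp4 : p % 4 = 3) (n : ℕ)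
    (hF : Fintype.card F % 4 = 3) (σ : ℤ)
    (hC : ∀ a : F, a ≠ 0 → ∀ ρ : ZMod p, (Cc p F a ρ : ℤ) = p ^ (2 * n + 2) +
        σ * quadraticChar F a * quadraticChar (ZMod p) ρ * p ^ (n + 1))
    {s t : ℤ} (hs : s = 1 ∨ s = -1) (ht : t = 1 ∨ t = -1) :
    4 * (Kc p F s t : ℤ) = (p - 1) * (p ^ (2 * n + 2) + σ * s * t * p ^ (n + 1)) := by
  obtain ⟨c, hc0, hc⟩ : ∃ c : F, c ≠ 0 ∧ quadraticChar F c = s := by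
    rcases hs with rfl | rfl
    · exact ⟨1, one_ne_zero, by simp⟩
    · exact ⟨-1, by simp, qc_neg_one hF⟩
  have hss : s * s = 1 := by rcases hs with rfl | rfl <;> rfl
  set f : F → ℤ := fun b =>
    if quadraticChar (ZMod p) (Algebra.trace (ZMod p) F b) = t then 1 else 0 with hf
  have h1 : ∑ y : F, f (c * y ^ 2) = 2 * (Kc p F s t : ℤ) := by
    rw [sum_sq_eq (ringChar_ne (p := p) hp4) (fun y => f (c * y))]
    have : ∀ y : F, ((quadraticChar F y : ℤ) + 1) * f (c * y) =
        (s * quadraticChar F (c * y) + 1) * f (c * y) := by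
      intro y
      rw [map_mul, hc]
      linear_combination (-(quadraticChar F y : ℤ) * f (c * y)) * hss
    simp only [Int.cast_id]
    rw [Finset.sum_congr rfl fun y _ => this y]
    have e := Equiv.sum_comp (Equiv.mulLeft₀ c hc0) (fun y => (s * quadraticChar F y + 1) * f y)
    refine Eq.trans e ?_
    rw [Kc, Finset.card_filter]
    push_cast
    rw [Finset.mul_sum]
    refine Finset.sum_congr rfl fun b _ => ?_
    by_cases hb : b = 0
    · subst hb
      rcases ht with rfl | rfl <;> simp [hf]
    · simp only [hf]
      rcases quadraticChar_dichotomy hb with h | h <;> rcases hs with rfl | rfl <;>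
        rw [h] <;> norm_num
  have h2 : ∑ y : F, f (c * y ^ 2) =
      ∑ ρ ∈ Finset.univ.filter (fun z : ZMod p => quadraticChar (ZMod p) z = t),
        (Cc p F c ρ : ℤ) := by
    simp only [Cc, Finset.card_filter]
    push_cast
    rw [Finset.sum_comm]
    refine Finset.sum_congr rfl fun y _ => ?_
    rw [Finset.sum_ite_eq]
    simp [hf]
  have h3 : ∑ ρ ∈ Finset.univ.filter (fun z : ZMod p => quadraticChar (ZMod p) z = t),
        (Cc p F c ρ : ℤ) =
      ∑ ρ ∈ Finset.univ.filter (fun z : ZMod p => quadraticChar (ZMod p) z = t),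
        ((p : ℤ) ^ (2 * n + 2) + σ * s * t * p ^ (n + 1)) := by
    refine Finset.sum_congr rfl fun ρ hρ => ?_
    rw [hC c hc0 ρ, hc, (Finset.mem_filter.1 hρ).2]
  rw [Finset.sum_const, nsmul_eq_mul] at h3
  have h4 := half_count (p := p) hp4 ht
  linear_combination (-2) * h1 + 2 * h2 + 2 * h3 +
    ((p : ℤ) ^ (2 * n + 2) + σ * s * t * p ^ (n + 1)) * h4

/-- monomials -/
noncomputable def Pol (p n : ℕ) [Fact p.Prime] (s e : ℤ) : MvPolynomial (ZMod p) ℤ :=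
  ∏ ρ : ZMod p, X ρ ^ (if s * quadraticChar (ZMod p) ρ * e = 1 then expB p n e else expA p n e)

theorem prod_split (f : ZMod p → MvPolynomial (ZMod p) ℤ) : ∏ ρ : ZMod p, f ρ =
    f 0 * ((∏ ρ ∈ Finset.univ.filter (fun ρ : ZMod p => quadraticChar (ZMod p) ρ = 1), f ρ) *
      (∏ ρ ∈ Finset.univ.filter (fun ρ : ZMod p => quadraticChar (ZMod p) ρ = -1), f ρ)) := by
  have h0 : f 0 = ∏ ρ : ZMod p, if ρ = 0 then f ρ else 1 := by simp
  rw [h0, Finset.prod_filter, Finset.prod_filter, ← Finset.prod_mul_distrib,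
    ← Finset.prod_mul_distrib]
  refine Finset.prod_congr rfl fun ρ _ => ?_
  by_cases h : ρ = 0
  · subst h; simp
  · rcases quadraticChar_dichotomy h with h' | h' <;> rw [h'] <;> simp [h]

theorem Pol_eq (n : ℕ) (s e : ℤ) : Pol p n s e = X 0 ^ expA p n e *
    ((∏ ρ ∈ Finset.univ.filter (fun ρ : ZMod p => quadraticChar (ZMod p) ρ = 1),
        X ρ ^ (if s * 1 * e = 1 then expB p n e else expA p n e)) *
      (∏ ρ ∈ Finset.univ.filter (fun ρ : ZMod p => quadraticChar (ZMod p) ρ = -1),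
        X ρ ^ (if s * (-1) * e = 1 then expB p n e else expA p n e))) := by
  rw [Pol, prod_split]
  congr 1
  · simp
  congr 1
  · refine Finset.prod_congr rfl fun ρ hρ => ?_
    rw [(Finset.mem_filter.1 hρ).2]
  · refine Finset.prod_congr rfl fun ρ hρ => ?_
    rw [(Finset.mem_filter.1 hρ).2]

theorem CWE_aux [DecidableEq F] (hp4 : p % 4 = 3) (n : ℕ)
    (hcard : Fintype.card F = p ^ (2 * n + 3)) :
    CWE p F = X 0 ^ ((p - 1) / 2 * p ^ (2 * n + 2))
      + ((p ^ (2 * n + 2) - 1 : ℕ) : MvPolynomial (ZMod p) ℤ)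
          * ∏ ρ : ZMod p, X ρ ^ ((p - 1) / 2 * p ^ (2 * n + 1))
      + (((p - 1) * (p ^ (2 * n + 2) + p ^ (n + 1)) / 4 : ℕ) : MvPolynomial (ZMod p) ℤ)
          * (Pol p n (-1) 1 + Pol p n 1 1)
      + (((p - 1) * (p ^ (2 * n + 2) - p ^ (n + 1)) / 4 : ℕ) : MvPolynomial (ZMod p) ℤ)
          * (Pol p n 1 (-1) + Pol p n (-1) (-1)) := by
  have hp1 : 1 ≤ p := (Fact.out : p.Prime).one_le
  have hF : Fintype.card F % 4 = 3 := by
    rw [hcard]; exact card_mod hp4 ⟨n + 1, by ring⟩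
  obtain ⟨σ, hσ, hcnt⟩ := counts (F := F) hp4 n hcard
  have hσσ : σ * σ = 1 := by rcases hσ with rfl | rfl <;> rfl
  have hK : ∀ {s t : ℤ}, (s = 1 ∨ s = -1) → (t = 1 ∨ t = -1) → _ :=
    fun hs ht => Kc_eq (F := F) hp4 n hF σ (fun a ha ρ => (hcnt a ha ρ).1) hs ht
  have hle : p ^ (n + 1) ≤ p ^ (2 * n + 2) := Nat.pow_le_pow_right hp1 (by omega)
  have hKp : ∀ s t : ℤ, (s = 1 ∨ s = -1) → (t = 1 ∨ t = -1) → σ * s * t = 1 →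
      Kc p F s t = (p - 1) * (p ^ (2 * n + 2) + p ^ (n + 1)) / 4 := by
    intro s t hs ht h
    have := hK hs ht
    rw [h] at this
    have h' : 4 * Kc p F s t = (p - 1) * (p ^ (2 * n + 2) + p ^ (n + 1)) := by
      zify [hp1]; rw [this]; ring
    omega
  have hKm : ∀ s t : ℤ, (s = 1 ∨ s = -1) → (t = 1 ∨ t = -1) → σ * s * t = -1 →
      Kc p F s t = (p - 1) * (p ^ (2 * n + 2) - p ^ (n + 1)) / 4 := by
    intro s t hs ht h
    have := hK hs ht
    rw [h] at this
    have h' : 4 * Kc p F s t = (p - 1) * (p ^ (2 * n + 2) - p ^ (n + 1)) := by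
      zify [hp1, hle]; rw [this]; ring
    omega
  have hKT : ((Finset.univ.filter (fun b : F => b ≠ 0 ∧ Algebra.trace (ZMod p) F b = 0)).card) =
      p ^ (2 * n + 2) - 1 := by
    have hall : ∀ b : F, (1 : ℤ) = (if b = 0 then 1 else 0) +
        (if b ≠ 0 ∧ Algebra.trace (ZMod p) F b = 0 then 1 else 0) +
      (if quadraticChar F b = 1 ∧ quadraticChar (ZMod p) (Algebra.trace (ZMod p) F b) = 1
        then 1 else 0) +
      (if quadraticChar F b = 1 ∧ quadraticChar (ZMod p) (Algebra.trace (ZMod p) F b) = -1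
        then 1 else 0) +
      (if quadraticChar F b = -1 ∧ quadraticChar (ZMod p) (Algebra.trace (ZMod p) F b) = 1
        then 1 else 0) +
      (if quadraticChar F b = -1 ∧ quadraticChar (ZMod p) (Algebra.trace (ZMod p) F b) = -1
        then 1 else 0) := by
      intro b
      by_cases hb : b = 0
      · subst hb; simp
      · by_cases hT : Algebra.trace (ZMod p) F b = 0
        · simp [hb, hT]
        · rcases quadraticChar_dichotomy hb with h | h <;>
          rcases quadraticChar_dichotomy hT with h' | h' <;> rw [h, h'] <;> norm_num [hb, hT]
    have hsum := Finset.sum_congr (rfl : (Finset.univ : Finset F) = Finset.univ)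
      fun b _ => hall b
    simp only [Finset.sum_add_distrib] at hsum
    simp only [Finset.sum_boole] at hsum
    have k1 := hK (s := 1) (t := 1) (by simp) (by simp)
    have k2 := hK (s := 1) (t := -1) (by simp) (by simp)
    have k3 := hK (s := -1) (t := 1) (by simp) (by simp)
    have k4 := hK (s := -1) (t := -1) (by simp) (by simp)
    simp only [Kc] at k1 k2 k3 k4
    have c0 : (Finset.univ.filter (fun b : F => b = 0)).card = 1 := by
      rw [Finset.filter_eq']; simp
    rw [c0] at hsum
    rw [Finset.sum_const, Finset.card_univ, hcard] at hsum
    have hpos : 1 ≤ p ^ (2 * n + 2) := Nat.one_le_pow _ _ hp1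
    zify [hpos]
    push_cast [nsmul_eq_mul] at hsum
    apply mul_left_cancel₀ (four_ne_zero : (4 : ℤ) ≠ 0)
    linear_combination (-4) * hsum - k1 - k2 - k3 - k4
  -- value at 0
  have v0 : ∏ ρ : ZMod p, (X ρ : MvPolynomial (ZMod p) ℤ) ^ (Nfun p F 0 ρ) =
      X 0 ^ ((p - 1) / 2 * p ^ (2 * n + 2)) := by
    have hz : ∀ ρ : ZMod p, ρ ≠ 0 → Nfun p F 0 ρ = 0 := by
      intro ρ hρ
      have h1 := Nfun_rel hp4 (0 : F) ρ
      have h2 : Cc p F 0 ρ = 0 := by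
        rw [Cc, Finset.card_eq_zero, Finset.filter_eq_empty_iff]
        intro x _ h
        apply hρ
        rw [← h]; simp
      omega
    have hN : Nfun p F 0 0 = (p - 1) / 2 * p ^ (2 * n + 2) := by
      have h1 := Nfun_rel hp4 (0 : F) 0
      have h2 : Cc p F 0 0 = p ^ (2 * n + 3) := by
        rw [Cc, ← hcard, ← Finset.card_univ]
        congr 1
        ext x; simp
      have h3 : Mc p F 0 0 = p ^ (2 * n + 2) := by
        have hpos : 1 ≤ p ^ (2 * n + 2) := Nat.one_le_pow _ _ hp1
        have : (Finset.univ.filter (fun x : F => Algebra.trace (ZMod p) F (0 * x ^ 2) = 0 ∧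
            Algebra.trace (ZMod p) F x = 0)) = insert 0
            (Finset.univ.filter (fun b : F => b ≠ 0 ∧ Algebra.trace (ZMod p) F b = 0)) := by
          ext x
          by_cases hx : x = 0 <;> simp [hx]
        rw [Mc, this, Finset.card_insert_of_notMem (by simp), hKT]
        omega
      rw [h2, h3] at h1
      obtain ⟨k, hk⟩ : ∃ k, p = 4 * k + 3 := ⟨p / 4, by omega⟩
      have hk1 : (p - 1) / 2 = 2 * k + 1 := by omega
      rw [hk1]
      have h4 : p ^ (2 * n + 3) = (4 * k + 3) * p ^ (2 * n + 2) := by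
        rw [← hk]; ring
      rw [h4] at h1
      linarith
    rw [Finset.prod_eq_single 0]
    · rw [hN]
    · intro ρ _ hρ
      rw [hz ρ hρ, pow_zero]
    · simp
  have v1 : ∀ b : F, b ≠ 0 → Algebra.trace (ZMod p) F b = 0 →
      ∏ ρ : ZMod p, (X ρ : MvPolynomial (ZMod p) ℤ) ^ (Nfun p F b⁻¹ ρ) =
      ∏ ρ : ZMod p, X ρ ^ ((p - 1) / 2 * p ^ (2 * n + 1)) := by
    intro b hb hT
    refine Finset.prod_congr rfl fun ρ _ => ?_
    congr 1
    have h1 := Nfun_rel hp4 b⁻¹ ρ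
    obtain ⟨h2, h3⟩ := hcnt b⁻¹ (inv_ne_zero hb) ρ
    rw [inv_inv, if_pos hT] at h3
    zify at h1
    obtain ⟨k, hk⟩ : ∃ k, p = 4 * k + 3 := ⟨p / 4, by omega⟩
    have hk1 : (p - 1) / 2 = 2 * k + 1 := by omega
    have hk2 : (p : ℤ) = 4 * k + 3 := by exact_mod_cast hk
    rw [hk1]
    have : 2 * (Nfun p F b⁻¹ ρ : ℤ) = 2 * ((2 * k + 1) * p ^ (2 * n + 1)) := by
      rw [h2, h3] at h1
      linear_combination h1 + (p : ℤ) ^ (2 * n + 1) * hk2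
    have := mul_left_cancel₀ (two_ne_zero) this
    exact_mod_cast this
  have v2 : ∀ b : F, b ≠ 0 → Algebra.trace (ZMod p) F b ≠ 0 →
      ∏ ρ : ZMod p, (X ρ : MvPolynomial (ZMod p) ℤ) ^ (Nfun p F b⁻¹ ρ) =
      Pol p n (σ * quadraticChar F b) (σ * quadraticChar F b *
        quadraticChar (ZMod p) (Algebra.trace (ZMod p) F b)) := by
    intro b hb hT
    refine Finset.prod_congr rfl fun ρ _ => ?_
    congr 1
    have h1 := Nfun_rel hp4 b⁻¹ ρ
    obtain ⟨h2, h3⟩ := hcnt b⁻¹ (inv_ne_zero hb) ρ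
    have hinv : quadraticChar F b⁻¹ = quadraticChar F b := by
      have : quadraticChar F b⁻¹ * quadraticChar F b = 1 := by
        rw [← map_mul, inv_mul_cancel₀ hb, map_one]
      rcases quadraticChar_dichotomy hb with h | h <;> rw [h] at this ⊢ <;> linarith
    rw [hinv] at h2 h3
    rw [inv_inv, if_neg hT] at h3
    zify at h1
    apply exp_eq hp4
    · rcases hσ with rfl | rfl <;> rcases quadraticChar_dichotomy hb with h | h <;> simp [h]
    · rcases hσ with rfl | rfl <;> rcases quadraticChar_dichotomy hb with h | h <;>
        rcases quadraticChar_dichotomy hT with h' | h' <;> simp [h, h']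
    · by_cases h : ρ = 0
      · left; simp [h]
      · right; exact quadraticChar_dichotomy h
    · rw [h2, h3] at h1
      simp only [quadraticChar_eq_zero_iff]
      linear_combination h1
  have key : ∀ b : F, ∏ ρ : ZMod p, (X ρ : MvPolynomial (ZMod p) ℤ) ^ (Nfun p F b⁻¹ ρ) =
      (if b = 0 then 1 else 0) * X 0 ^ ((p - 1) / 2 * p ^ (2 * n + 2)) +
      (if b ≠ 0 ∧ Algebra.trace (ZMod p) F b = 0 then 1 else 0) *
        ∏ ρ : ZMod p, X ρ ^ ((p - 1) / 2 * p ^ (2 * n + 1)) +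
      (if quadraticChar F b = 1 ∧ quadraticChar (ZMod p) (Algebra.trace (ZMod p) F b) = 1
        then 1 else 0) * Pol p n σ σ +
      (if quadraticChar F b = 1 ∧ quadraticChar (ZMod p) (Algebra.trace (ZMod p) F b) = -1
        then 1 else 0) * Pol p n σ (-σ) +
      (if quadraticChar F b = -1 ∧ quadraticChar (ZMod p) (Algebra.trace (ZMod p) F b) = 1
        then 1 else 0) * Pol p n (-σ) (-σ) +
      (if quadraticChar F b = -1 ∧ quadraticChar (ZMod p) (Algebra.trace (ZMod p) F b) = -1
        then 1 else 0) * Pol p n (-σ) σ := by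
    intro b
    by_cases hb : b = 0
    · subst hb; rw [inv_zero, v0]; simp
    · by_cases hT : Algebra.trace (ZMod p) F b = 0
      · rw [v1 b hb hT]; simp [hb, hT]
      · rw [v2 b hb hT]
        rcases quadraticChar_dichotomy hb with h | h <;>
        rcases quadraticChar_dichotomy hT with h' | h' <;> rw [h, h'] <;> norm_num [hb, hT]
  have hmain : CWE p F = X 0 ^ ((p - 1) / 2 * p ^ (2 * n + 2)) +
      ((p ^ (2 * n + 2) - 1 : ℕ) : MvPolynomial (ZMod p) ℤ) *
        ∏ ρ : ZMod p, X ρ ^ ((p - 1) / 2 * p ^ (2 * n + 1)) +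
      (Kc p F 1 1 : MvPolynomial (ZMod p) ℤ) * Pol p n σ σ +
      (Kc p F 1 (-1) : MvPolynomial (ZMod p) ℤ) * Pol p n σ (-σ) +
      (Kc p F (-1) 1 : MvPolynomial (ZMod p) ℤ) * Pol p n (-σ) (-σ) +
      (Kc p F (-1) (-1) : MvPolynomial (ZMod p) ℤ) * Pol p n (-σ) σ := by
    rw [CWE, ← Equiv.sum_comp (Equiv.inv F)]
    simp only [Equiv.inv_apply]
    rw [Finset.sum_congr rfl fun b _ => key b]
    simp only [Finset.sum_add_distrib, ← Finset.sum_mul, Finset.sum_boole]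
    rw [hKT]
    have c0 : (Finset.univ.filter (fun b : F => b = 0)).card = 1 := by
      rw [Finset.filter_eq']; simp
    rw [c0]
    simp only [Kc, Nat.cast_one, one_mul]
  rw [hmain]
  rcases hσ with rfl | rfl
  · rw [hKp 1 1 (by simp) (by simp) (by simp), hKp (-1) (-1) (by simp) (by simp) (by simp),
      hKm 1 (-1) (by simp) (by simp) (by simp), hKm (-1) 1 (by simp) (by simp) (by simp)]
    ring
  · rw [hKm 1 1 (by simp) (by simp) (by simp), hKm (-1) (-1) (by simp) (by simp) (by simp),
      hKp 1 (-1) (by simp) (by simp) (by simp), hKp (-1) 1 (by simp) (by simp) (by simp)]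
    rw [neg_neg]
    ring

end Main2

/-- the complete weight enumerator of `C_D` for `p ≡ 3 (mod 4)`,
`m ≥ 3` odd.  Here `A_ε = ((p-1)/2)(p^{m-2} - ε p^{(m-3)/2})` and
`B_ε = (p-1)p^{m-2}/2 + ε ((p+1)/2) p^{(m-3)/2}`. -/
theorem stmt_4 (p m : ℕ) [Fact p.Prime] (hp4 : p % 4 = 3) (hm : 3 ≤ m) (hmo : Odd m)
    (F : Type) [Field F] [Fintype F] [Algebra (ZMod p) F]
    (hcard : Fintype.card F = p ^ m) :
    CWE p F =
      X 0 ^ ((p - 1) / 2 * p ^ (m - 1))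
      + ((p ^ (m - 1) - 1 : ℕ) : MvPolynomial (ZMod p) ℤ)
          * ∏ ρ : ZMod p, X ρ ^ ((p - 1) / 2 * p ^ (m - 2))
      + (((p - 1) * (p ^ (m - 1) + p ^ ((m - 1) / 2)) / 4 : ℕ) : MvPolynomial (ZMod p) ℤ)
          * X 0 ^ ((p - 1) / 2 * (p ^ (m - 2) - p ^ ((m - 3) / 2)))
          * ((∏ ρ ∈ Finset.univ.filter (fun ρ : ZMod p => quadraticChar (ZMod p) ρ = 1),
                X ρ ^ ((p - 1) / 2 * (p ^ (m - 2) - p ^ ((m - 3) / 2))))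
              * (∏ z ∈ Finset.univ.filter (fun z : ZMod p => quadraticChar (ZMod p) z = -1),
                X z ^ ((p - 1) / 2 * p ^ (m - 2) + (p + 1) / 2 * p ^ ((m - 3) / 2)))
            + (∏ ρ ∈ Finset.univ.filter (fun ρ : ZMod p => quadraticChar (ZMod p) ρ = -1),
                X ρ ^ ((p - 1) / 2 * (p ^ (m - 2) - p ^ ((m - 3) / 2))))
              * (∏ z ∈ Finset.univ.filter (fun z : ZMod p => quadraticChar (ZMod p) z = 1),
                X z ^ ((p - 1) / 2 * p ^ (m - 2) + (p + 1) / 2 * p ^ ((m - 3) / 2))))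
      + (((p - 1) * (p ^ (m - 1) - p ^ ((m - 1) / 2)) / 4 : ℕ) : MvPolynomial (ZMod p) ℤ)
          * X 0 ^ ((p - 1) / 2 * (p ^ (m - 2) + p ^ ((m - 3) / 2)))
          * ((∏ ρ ∈ Finset.univ.filter (fun ρ : ZMod p => quadraticChar (ZMod p) ρ = 1),
                X ρ ^ ((p - 1) / 2 * (p ^ (m - 2) + p ^ ((m - 3) / 2))))
              * (∏ z ∈ Finset.univ.filter (fun z : ZMod p => quadraticChar (ZMod p) z = -1),
                X z ^ ((p - 1) / 2 * p ^ (m - 2) - (p + 1) / 2 * p ^ ((m - 3) / 2)))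
            + (∏ ρ ∈ Finset.univ.filter (fun ρ : ZMod p => quadraticChar (ZMod p) ρ = -1),
                X ρ ^ ((p - 1) / 2 * (p ^ (m - 2) + p ^ ((m - 3) / 2))))
              * (∏ z ∈ Finset.univ.filter (fun z : ZMod p => quadraticChar (ZMod p) z = 1),
                X z ^ ((p - 1) / 2 * p ^ (m - 2) - (p + 1) / 2 * p ^ ((m - 3) / 2)))) := by
  classical
  obtain ⟨n, rfl⟩ : ∃ n, m = 2 * n + 3 := by
    obtain ⟨k, rfl⟩ := hmo
    exact ⟨k - 1, by omega⟩
  have e1 : 2 * n + 3 - 1 = 2 * n + 2 := by omega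
  have e2 : 2 * n + 3 - 2 = 2 * n + 1 := by omega
  have e3 : (2 * n + 3 - 3) / 2 = n := by omega
  have e4 : (2 * n + 2) / 2 = n + 1 := by omega
  rw [e1, e2, e3, e4, CWE_aux hp4 n hcard]
  simp only [Pol_eq]
  norm_num [expA, expB]
  ring
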